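/- If (μₙ) is a sequence of Borel probability measures on Gr converging weakly to μ, then the associated edge measures (μ⃗ₙ) on Gr⃗ converge weakly to μ⃗. -/

import Mathlib

open MeasureTheory Filter Topology SimpleGraph ENNReal

/-- A rooted graph: a graph together with a distinguished root vertex. -/
structure RGraph : Type 1 where
  V : Type
  G : SimpleGraph V
  root : V

/-- Rooted graph isomorphism (equality of isomorphism classes). -/
def RGraph.Equiv (X Y : RGraph) : Prop :=
  ∃ e : X.G ≃g Y.G, e X.root = Y.root

/-- The rooted ball of radius `r` around the root. -/
def RGraph.ball (X : RGraph) (r : ℕ) : RGraph where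
  V := ↥{v : X.V | X.G.dist X.root v ≤ r}
  G := X.G.induce {v : X.V | X.G.dist X.root v ≤ r}
  root := ⟨X.root, by simp [SimpleGraph.dist_self]⟩

/-- `α` is a rooted `r`-ball: every vertex is within distance `r` of the root. -/
def RGraph.IsBall (α : RGraph) (r : ℕ) : Prop :=
  ∀ v : α.V, α.G.dist α.root v ≤ r

/-- A rooted graph which is countable, connected and has all degrees `≤ Δ`. -/
structure PRGraph (Δ : ℕ) extends RGraph where
  countable : Countable V
  connected : G.Connected
  degbd : ∀ v : V, (G.neighborSet v).Finite ∧ (G.neighborSet v).ncard ≤ Δ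

def rsetoid (Δ : ℕ) : Setoid (PRGraph Δ) where
  r X Y := X.toRGraph.Equiv Y.toRGraph
  iseqv := by
    constructor
    · intro X
      exact ⟨SimpleGraph.Iso.refl, rfl⟩
    · rintro X Y ⟨e, h⟩
      exact ⟨e.symm, by rw [← h]; exact e.symm_apply_apply _⟩
    · rintro X Y Z ⟨e, he⟩ ⟨f, hf⟩
      exact ⟨e.trans f, by show f (e _) = _; rw [he, hf]⟩

/-- The space of isomorphism classes of countable connected rooted graphs with
degree bound `Δ`. -/
def Gr (Δ : ℕ) := Quotient (rsetoid Δ)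

def mkG {Δ : ℕ} (X : PRGraph Δ) : Gr Δ := Quotient.mk (rsetoid Δ) X

open Classical in
/-- The ultrametric `ρ` on `Gr Δ`. -/
noncomputable def rdist {Δ : ℕ} (q₁ q₂ : Gr Δ) : ℝ :=
  if q₁ = q₂ then 0
  else (2 : ℝ) ^ (-((sSup {t : ℕ | ∃ X Y : PRGraph Δ, q₁ = mkG X ∧ q₂ = mkG Y ∧
    (X.toRGraph.ball t).Equiv (Y.toRGraph.ball t)} : ℕ) : ℤ))

/-- The basic clopen set `T_r(Gr, α)` of classes whose `r`-ball is `α`. -/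
def Tset (Δ r : ℕ) (α : RGraph) : Set (Gr Δ) :=
  {q | ∃ X : PRGraph Δ, q = mkG X ∧ (X.toRGraph.ball r).Equiv α}
/-- A birooted graph: a graph with an ordered pair of distinguished vertices. -/
structure BRGraph : Type 1 where
  V : Type
  G : SimpleGraph V
  root₁ : V
  root₂ : V

/-- Birooted graph isomorphism. -/
def BRGraph.Equiv (X Y : BRGraph) : Prop :=
  ∃ e : X.G ≃g Y.G, e X.root₁ = Y.root₁ ∧ e X.root₂ = Y.root₂

/-- The birooted ball of radius `r` around the first root (always containing the
second root). -/
def BRGraph.ball (X : BRGraph) (r : ℕ) : BRGraph where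
  V := ↥{v : X.V | X.G.dist X.root₁ v ≤ r ∨ v = X.root₂}
  G := X.G.induce {v : X.V | X.G.dist X.root₁ v ≤ r ∨ v = X.root₂}
  root₁ := ⟨X.root₁, Or.inl (by simp [SimpleGraph.dist_self])⟩
  root₂ := ⟨X.root₂, Or.inr rfl⟩

/-- `α` is a birooted `r`-ball: every vertex is within distance `r` of the first root. -/
def BRGraph.IsBall (α : BRGraph) (r : ℕ) : Prop :=
  ∀ v : α.V, α.G.dist α.root₁ v ≤ r

/-- Swapping the two roots of a birooted graph. -/
def BRGraph.swap (X : BRGraph) : BRGraph := ⟨X.V, X.G, X.root₂, X.root₁⟩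

/-- A birooted graph with adjacent roots which is countable, connected and has all
degrees `≤ Δ`. -/
structure BPRGraph (Δ : ℕ) where
  V : Type
  G : SimpleGraph V
  root₁ : V
  root₂ : V
  adj : G.Adj root₁ root₂
  countable : Countable V
  connected : G.Connected
  degbd : ∀ v : V, (G.neighborSet v).Finite ∧ (G.neighborSet v).ncard ≤ Δ

def BPRGraph.toBR {Δ : ℕ} (X : BPRGraph Δ) : BRGraph := ⟨X.V, X.G, X.root₁, X.root₂⟩

def BPRGraph.swap {Δ : ℕ} (X : BPRGraph Δ) : BPRGraph Δ :=
  ⟨X.V, X.G, X.root₂, X.root₁, X.adj.symm, X.countable, X.connected, X.degbd⟩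

def bsetoid (Δ : ℕ) : Setoid (BPRGraph Δ) where
  r X Y := X.toBR.Equiv Y.toBR
  iseqv := by
    constructor
    · intro X
      exact ⟨SimpleGraph.Iso.refl, rfl, rfl⟩
    · rintro X Y ⟨e, h₁, h₂⟩
      exact ⟨e.symm, by rw [← h₁]; exact e.symm_apply_apply _,
        by rw [← h₂]; exact e.symm_apply_apply _⟩
    · rintro X Y Z ⟨e, he₁, he₂⟩ ⟨f, hf₁, hf₂⟩
      exact ⟨e.trans f, by show f (e _) = _; rw [he₁, hf₁],
        by show f (e _) = _; rw [he₂, hf₂]⟩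

/-- The space of isomorphism classes of countable connected birooted graphs with
degree bound `Δ`. -/
def BGr (Δ : ℕ) := Quotient (bsetoid Δ)

def mkB {Δ : ℕ} (X : BPRGraph Δ) : BGr Δ := Quotient.mk (bsetoid Δ) X

open Classical in
/-- The ultrametric `ρ⃗` on `BGr Δ`. -/
noncomputable def brdist {Δ : ℕ} (q₁ q₂ : BGr Δ) : ℝ :=
  if q₁ = q₂ then 0
  else (2 : ℝ) ^ (-((sSup {t : ℕ | ∃ X Y : BPRGraph Δ, q₁ = mkB X ∧ q₂ = mkB Y ∧
    (X.toBR.ball t).Equiv (Y.toBR.ball t)} : ℕ) : ℤ))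

/-- The basic clopen set `T_r(Gr⃗, α⃗)` of birooted classes whose `r`-ball is `α⃗`. -/
def TsetB (Δ r : ℕ) (α : BRGraph) : Set (BGr Δ) :=
  {q | ∃ X : BPRGraph Δ, q = mkB X ∧ (X.toBR.ball r).Equiv α}

/-- The root-swapping involution `ι` on `BGr Δ`. -/
def iota {Δ : ℕ} : BGr Δ → BGr Δ :=
  Quotient.map BPRGraph.swap (by
    rintro X Y ⟨e, h₁, h₂⟩
    exact ⟨e, h₂, h₁⟩)

/-- The birooted graph obtained from a rooted graph and a neighbour of the root. -/
def PRGraph.bi {Δ : ℕ} (X : PRGraph Δ) (x : X.V) (h : X.G.Adj X.root x) : BPRGraph Δ :=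
  ⟨X.V, X.G, X.root, x, h, X.countable, X.connected, X.degbd⟩

/-- `f_A [G,o] = |{x ∈ N_G(o) : [G,o,x] ∈ A}|`, computed on the canonical
representative of the class. -/
noncomputable def fA {Δ : ℕ} (A : Set (BGr Δ)) (q : Gr Δ) : ℕ :=
  Set.ncard {p : (Quotient.out q).G.neighborSet (Quotient.out q).root |
    mkB ((Quotient.out q).bi p.1 p.2) ∈ A}

/-- `[G,o] ↦ Σ_{x ∈ N_G(o)} F [G,o,x]`. -/
noncomputable def outSum {Δ : ℕ} (F : BGr Δ → ℝ≥0∞) (q : Gr Δ) : ℝ≥0∞ :=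
  ∑' p : (Quotient.out q).G.neighborSet (Quotient.out q).root,
    F (mkB ((Quotient.out q).bi p.1 p.2))

/-- `[G,o] ↦ Σ_{x ∈ N_G(o)} F [G,x,o]`. -/
noncomputable def inSum {Δ : ℕ} (F : BGr Δ → ℝ≥0∞) (q : Gr Δ) : ℝ≥0∞ :=
  ∑' p : (Quotient.out q).G.neighborSet (Quotient.out q).root,
    F (mkB (((Quotient.out q).bi p.1 p.2).swap))

/-- Unimodularity of a measure on `Gr Δ`. -/
def Unimodular {Δ : ℕ} [MeasurableSpace (Gr Δ)] [MeasurableSpace (BGr Δ)]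
    (μ : Measure (Gr Δ)) : Prop :=
  ∀ F : BGr Δ → ℝ≥0∞, Measurable F →
    ∫⁻ q, inSum F q ∂μ = ∫⁻ q, outSum F q ∂μ

/-- The kernel sending `[G,o]` to `Σ_{x ∈ N_G(o)} δ_{[G,o,x]}`. -/
noncomputable def edgeKer {Δ : ℕ} [MeasurableSpace (BGr Δ)] (q : Gr Δ) :
    Measure (BGr Δ) :=
  haveI : Countable (Quotient.out q).V := (Quotient.out q).countable
  Measure.sum (fun p : (Quotient.out q).G.neighborSet (Quotient.out q).root =>
    Measure.dirac (mkB ((Quotient.out q).bi p.1 p.2)))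

/-- The edge measure `ν⃗` on `BGr Δ` associated to a measure `ν` on `Gr Δ`:
`ν⃗(A) = ∫ |{x ∈ N_G(o) : [G,o,x] ∈ A}| dν[G,o]`. -/
noncomputable def vecM {Δ : ℕ} [MeasurableSpace (Gr Δ)] [MeasurableSpace (BGr Δ)]
    (ν : Measure (Gr Δ)) : Measure (BGr Δ) :=
  ν.bind edgeKer

/-- Weak convergence of a sequence of Borel measures. -/
def WeakConv {α : Type*} [TopologicalSpace α] [MeasurableSpace α]
    (μn : ℕ → Measure α) (μ : Measure α) : Prop :=
  ∀ f : α → ℝ, Continuous f →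
    Tendsto (fun n => ∫ x, f x ∂(μn n)) atTop (𝓝 (∫ x, f x ∂μ))
/-- The connected component of `x` in a finite graph `G` with degree bound `Δ`,
viewed as a rooted graph with root `x`. -/
noncomputable def compPR {V : Type} [Fintype V] (G : SimpleGraph V) {Δ : ℕ}
    (hdeg : ∀ v : V, (G.neighborSet v).ncard ≤ Δ) (x : V) : PRGraph Δ where
  V := ↥{y : V | G.Reachable x y}
  G := G.induce {y : V | G.Reachable x y}
  root := ⟨x, ⟨Walk.nil⟩⟩
  countable := by infer_instance
  connected := by
    classical
    apply SimpleGraph.induce_connected_of_patches x (by exact ⟨Walk.nil⟩)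
    intro v hv
    obtain ⟨p⟩ := hv
    refine ⟨{w | w ∈ p.support}, ?_, p.start_mem_support, p.end_mem_support, ?_⟩
    · intro w hw
      exact ⟨(p.takeUntil w hw)⟩
    · exact (p.connected_induce_support _ _)
  degbd := by
    intro v
    constructor
    · exact Set.toFinite _
    · have himg : Subtype.val '' ((G.induce {y : V | G.Reachable x y}).neighborSet v)
          ⊆ G.neighborSet v.1 := by
        rintro _ ⟨w, hw, rfl⟩
        exact hw
      calc ((G.induce {y : V | G.Reachable x y}).neighborSet v).ncard
          = (Subtype.val '' ((G.induce {y : V | G.Reachable x y}).neighborSet v)).ncard :=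
            (Set.ncard_image_of_injective _ Subtype.val_injective).symm
        _ ≤ (G.neighborSet v.1).ncard := Set.ncard_le_ncard himg (Set.toFinite _)
        _ ≤ Δ := hdeg v.1

/-- The law `Ψ(G)` of a finite graph `G`: the distribution of the rooted connected
component `[G_o, o]` of a uniformly random vertex `o`. -/
noncomputable def law {V : Type} [Fintype V] (G : SimpleGraph V) {Δ : ℕ}
    (hdeg : ∀ v : V, (G.neighborSet v).ncard ≤ Δ) [MeasurableSpace (Gr Δ)] :
    Measure (Gr Δ) :=
  (Fintype.card V : ℝ≥0∞)⁻¹ • ∑ x : V, Measure.dirac (mkG (compPR G hdeg x))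

lemma RGraph.Equiv.symm {X Y : RGraph} : X.Equiv Y → Y.Equiv X := by
  rintro ⟨e, h⟩
  exact ⟨e.symm, by rw [← h]; exact e.symm_apply_apply _⟩

lemma RGraph.Equiv.trans {X Y Z : RGraph} : X.Equiv Y → Y.Equiv Z → X.Equiv Z := by
  rintro ⟨e, he⟩ ⟨f, hf⟩
  exact ⟨e.trans f, by show f (e _) = _; rw [he, hf]⟩

lemma SimpleGraph.Iso.dist_apply {V W : Type*} {G : SimpleGraph V} {H : SimpleGraph W}
    (e : G ≃g H) (hG : G.Connected) (hH : H.Connected) (u v : V) :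
    H.dist (e u) (e v) = G.dist u v := by
  apply le_antisymm
  · obtain ⟨p, hp⟩ := hG.exists_walk_length_eq_dist u v
    rw [← hp, ← Walk.length_map e.toHom p]
    exact dist_le _
  · obtain ⟨p, hp⟩ := hH.exists_walk_length_eq_dist (e u) (e v)
    rw [← hp, ← Walk.length_map e.symm.toHom p]
    have := dist_le (p.map e.symm.toHom)
    simpa using this

lemma PRGraph.ball_equiv {Δ : ℕ} {X Y : PRGraph Δ} (h : X.toRGraph.Equiv Y.toRGraph) (r : ℕ) :
    (X.toRGraph.ball r).Equiv (Y.toRGraph.ball r) := by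
  obtain ⟨e, he⟩ := h
  refine ⟨e.induce (s := {v | X.G.dist X.root v ≤ r}) (t := {v | Y.G.dist Y.root v ≤ r}) ?_, ?_⟩
  · refine ⟨fun v hv => ?_, e.injective.injOn, fun w hw => ⟨e.symm w, ?_, by simp⟩⟩
    · have := e.dist_apply X.connected Y.connected X.root v
      simp only [Set.mem_ofPred_eq] at hv ⊢
      rwa [← he, this]
    · have := e.dist_apply X.connected Y.connected X.root (e.symm w)
      rw [he] at this
      simp only [Set.mem_ofPred_eq] at hw ⊢
      rw [← this]; simpa using hw
  · exact Subtype.ext he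

/-- The rooted graph obtained by forgetting the second root. -/
def BPRGraph.toPR {Δ : ℕ} (X : BPRGraph Δ) : PRGraph Δ :=
  ⟨⟨X.V, X.G, X.root₁⟩, X.countable, X.connected, X.degbd⟩

lemma exists_induce_iso_of_eq {V W : Type*} {G : SimpleGraph V} {H : SimpleGraph W}
    {S S' : Set V} {T T' : Set W} (hS : S = S') (hT : T = T') (e : G.induce S ≃g H.induce T) :
    ∃ e' : G.induce S' ≃g H.induce T',
      ∀ (v : V) (hv : v ∈ S) (hv' : v ∈ S'), (e' ⟨v, hv'⟩ : W) = e ⟨v, hv⟩ := by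
  subst hS hT
  exact ⟨e, fun _ _ _ => rfl⟩

lemma BPRGraph.setOf_dist_or_eq {Δ : ℕ} (X : BPRGraph Δ) {r : ℕ} (hr : 1 ≤ r) :
    {v | X.G.dist X.root₁ v ≤ r ∨ v = X.root₂} = {v | X.G.dist X.root₁ v ≤ r} := by
  ext v
  simp only [Set.mem_ofPred_eq, or_iff_left_iff_imp]
  rintro rfl
  rwa [dist_eq_one_iff_adj.2 X.adj]

lemma BPRGraph.toPR_ball_equiv {Δ : ℕ} {X Y : BPRGraph Δ} {r : ℕ} (hr : 1 ≤ r)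
    (h : (X.toBR.ball r).Equiv (Y.toBR.ball r)) :
    (X.toPR.toRGraph.ball r).Equiv (Y.toPR.toRGraph.ball r) := by
  obtain ⟨e, h₁, -⟩ := h
  obtain ⟨e', he'⟩ := exists_induce_iso_of_eq (X.setOf_dist_or_eq hr) (Y.setOf_dist_or_eq hr) e
  refine ⟨e', Subtype.ext ?_⟩
  exact (he' X.root₁ (by simp) (by simp)).trans (congrArg Subtype.val h₁)

lemma PRGraph.exists_neighborSet_equiv {Δ : ℕ} {X Y : PRGraph Δ} {r : ℕ} (hr : 1 ≤ r)
    (h : (X.toRGraph.ball r).Equiv (Y.toRGraph.ball r)) :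
    ∃ e : X.G.neighborSet X.root ≃ Y.G.neighborSet Y.root, ∀ p,
      ((X.bi p.1 p.2).toBR.ball r).Equiv ((Y.bi (e p).1 (e p).2).toBR.ball r) := by
  obtain ⟨φ, hφ⟩ := h
  have memX (p : X.G.neighborSet X.root) : X.G.dist X.root p ≤ r := by
    rwa [dist_eq_one_iff_adj.2 p.2]
  have memY (p : Y.G.neighborSet Y.root) : Y.G.dist Y.root p ≤ r := by
    rwa [dist_eq_one_iff_adj.2 p.2]
  have hφ' : φ.symm (Y.toRGraph.ball r).root = (X.toRGraph.ball r).root := by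
    rw [← hφ]; exact φ.symm_apply_apply _
  have adjX (p : X.G.neighborSet X.root) :
      Y.G.Adj Y.root (φ ⟨p, memX p⟩).1 := by
    have : (X.toRGraph.ball r).G.Adj (X.toRGraph.ball r).root ⟨p, memX p⟩ := p.2
    have h' := φ.map_adj_iff.2 this
    rwa [hφ] at h'
  have adjY (p : Y.G.neighborSet Y.root) :
      X.G.Adj X.root (φ.symm ⟨p, memY p⟩).1 := by
    have : (Y.toRGraph.ball r).G.Adj (Y.toRGraph.ball r).root ⟨p, memY p⟩ := p.2
    have h' := φ.symm.map_adj_iff.2 this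
    rwa [hφ'] at h'
  refine ⟨⟨fun p => ⟨(φ ⟨p, memX p⟩).1, adjX p⟩, fun p => ⟨(φ.symm ⟨p, memY p⟩).1, adjY p⟩,
    fun p => Subtype.ext ?_, fun p => Subtype.ext ?_⟩, fun p => ?_⟩
  · exact congrArg (fun v : (X.toRGraph.ball r).V => v.1) (φ.symm_apply_apply ⟨p, memX p⟩)
  · exact congrArg (fun v : (Y.toRGraph.ball r).V => v.1) (φ.apply_symm_apply ⟨p, memY p⟩)
  · obtain ⟨e', he'⟩ := exists_induce_iso_of_eq
      ((X.bi p.1 p.2).setOf_dist_or_eq hr).symm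
      ((Y.bi (φ ⟨p, memX p⟩).1 (adjX p)).setOf_dist_or_eq hr).symm φ
    refine ⟨e', Subtype.ext ?_, Subtype.ext ?_⟩
    · exact (he' X.root (X.toRGraph.ball r).root.2 ((X.bi p.1 p.2).toBR.ball r).root₁.2).trans
        (congrArg Subtype.val hφ)
    · exact he' p.1 (memX p) (Or.inr rfl)

/-- If the classes of `X` and `Y` are at distance less than one, then the neighbours of the roots
can be matched so that no distance between corresponding birooted classes exceeds
the distance of the rooted classes. -/
lemma exists_neighborSet_equiv_brdist_le {Δ : ℕ} {X Y : PRGraph Δ}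
    (h : rdist (mkG X) (mkG Y) < 1) :
    ∃ e : X.G.neighborSet X.root ≃ Y.G.neighborSet Y.root, ∀ p,
      brdist (mkB (X.bi p.1 p.2)) (mkB (Y.bi (e p).1 (e p).2)) ≤ rdist (mkG X) (mkG Y) := by
  by_cases hXY : mkG X = mkG Y
  · obtain ⟨φ, hφ⟩ : X.toRGraph.Equiv Y.toRGraph := Quotient.exact hXY
    have adjX (p : X.G.neighborSet X.root) : Y.G.Adj Y.root (φ p) := by
      rw [← hφ, φ.map_adj_iff]; exact p.2
    have adjY (p : Y.G.neighborSet Y.root) : X.G.Adj X.root (φ.symm p) := by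
      rw [← φ.map_adj_iff, hφ, φ.apply_symm_apply]; exact p.2
    refine ⟨⟨fun p => ⟨φ p, adjX p⟩, fun p => ⟨φ.symm p, adjY p⟩, fun p => by simp,
      fun p => by simp⟩, fun p => ?_⟩
    have : mkB (X.bi p.1 p.2) = mkB (Y.bi (φ p) (adjX p)) := Quotient.sound ⟨φ, hφ, rfl⟩
    simp only [Equiv.coe_fn_mk, this, hXY]
    simp [brdist, rdist]
  set S := {t : ℕ | ∃ X' Y' : PRGraph Δ, mkG X = mkG X' ∧ mkG Y = mkG Y' ∧
    (X'.toRGraph.ball t).Equiv (Y'.toRGraph.ball t)}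
  have hd : rdist (mkG X) (mkG Y) = (2 : ℝ) ^ (-((sSup S : ℕ) : ℤ)) := if_neg hXY
  have hs : 1 ≤ sSup S := by
    by_contra! h0
    rw [hd, Nat.lt_one_iff.1 h0] at h
    simp at h
  have hbdd : BddAbove S := by
    by_contra hb
    rw [Nat.sSup_of_not_bddAbove hb] at hs
    omega
  have hne : S.Nonempty := by
    by_contra! he
    simp [he] at hs
  obtain ⟨X', Y', hX, hY, hball⟩ := Nat.sSup_mem hne hbdd
  replace hX : X.toRGraph.Equiv X'.toRGraph := Quotient.exact hX
  replace hY : Y.toRGraph.Equiv Y'.toRGraph := Quotient.exact hY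
  obtain ⟨e, he⟩ := PRGraph.exists_neighborSet_equiv hs
    ((PRGraph.ball_equiv hX _).trans (hball.trans (PRGraph.ball_equiv hY _).symm))
  refine ⟨e, fun p => ?_⟩
  by_cases hp : mkB (X.bi p.1 p.2) = mkB (Y.bi (e p).1 (e p).2)
  · simp only [brdist, hp, if_true, hd]
    positivity
  rw [hd, brdist, if_neg hp]
  refine zpow_le_zpow_right₀ one_le_two (neg_le_neg (Nat.cast_le.2 (le_csSup ?_ ?_)))
  · obtain ⟨B, hB⟩ := hbdd
    refine ⟨B, ?_⟩
    rintro t ⟨X'', Y'', hX, hY, ht⟩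
    rcases Nat.eq_zero_or_pos t with rfl | h0
    · exact Nat.zero_le _
    obtain ⟨f, hf, -⟩ : (X.bi p.1 p.2).toBR.Equiv X''.toBR := Quotient.exact hX
    obtain ⟨g, hg, -⟩ : (Y.bi (e p).1 (e p).2).toBR.Equiv Y''.toBR := Quotient.exact hY
    exact hB ⟨X''.toPR, Y''.toPR, Quotient.sound ⟨f, hf⟩, Quotient.sound ⟨g, hg⟩,
      BPRGraph.toPR_ball_equiv h0 ht⟩
  · exact ⟨_, _, rfl, rfl, he p⟩

/-- The neighbours of the root in the canonical representative of a class. -/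
abbrev Gr.RootNeighbors {Δ : ℕ} (q : Gr Δ) : Type :=
  (Quotient.out q).G.neighborSet (Quotient.out q).root

/-- The birooted class given by a neighbour of the root in the canonical representative. -/
noncomputable def Gr.bi {Δ : ℕ} (q : Gr Δ) (p : q.RootNeighbors) : BGr Δ :=
  mkB ((Quotient.out q).bi p.1 p.2)

instance {Δ : ℕ} (q : Gr Δ) : Finite q.RootNeighbors :=
  ((Quotient.out q).degbd _).1

noncomputable instance {Δ : ℕ} (q : Gr Δ) : Fintype q.RootNeighbors :=
  Fintype.ofFinite _

lemma mkG_out {Δ : ℕ} (q : Gr Δ) : mkG (Quotient.out q) = q := Quotient.out_eq q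

lemma Gr.card_rootNeighbors_le {Δ : ℕ} (q : Gr Δ) : Fintype.card q.RootNeighbors ≤ Δ := by
  rw [← Nat.card_eq_fintype_card]
  exact ((Quotient.out q).degbd _).2

section Metric

variable {Δ : ℕ} [MetricSpace (Gr Δ)] [MetricSpace (BGr Δ)]

/-- Properties that hold near each `[G, o, x]`, with `x` a neighbour of the root, transfer to
the neighbours of the root in every rooted graph close to `[G, o]`. -/
lemma Gr.eventually_exists_equiv (hdist : ∀ a b : Gr Δ, dist a b = rdist a b)
    (hbdist : ∀ a b : BGr Δ, dist a b = brdist a b) (q : Gr Δ)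
    {P : q.RootNeighbors → BGr Δ → Prop} (hP : ∀ p, ∀ᶠ b in 𝓝 (q.bi p), P p b) :
    ∀ᶠ q' in 𝓝 q, ∃ e : q.RootNeighbors ≃ q'.RootNeighbors, ∀ p, P p (q'.bi (e p)) := by
  simp only [Metric.eventually_nhds_iff] at hP
  choose ε hε hεP using hP
  have hlt : ∀ᶠ q' in 𝓝 q, ∀ p, Dist.dist q' q < ε p :=
    eventually_all.2 fun p => Metric.ball_mem_nhds q (hε p)
  filter_upwards [hlt, Metric.ball_mem_nhds q one_pos] with q' hq' h1
  rw [Metric.mem_ball, _root_.dist_comm, hdist, ← mkG_out q, ← mkG_out q'] at h1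
  obtain ⟨e, he⟩ := exists_neighborSet_equiv_brdist_le h1
  refine ⟨e, fun p => hεP p ?_⟩
  rw [_root_.dist_comm, hbdist]
  refine (he p).trans_lt ?_
  rw [mkG_out, mkG_out, ← hdist, _root_.dist_comm]
  exact hq' p

lemma Gr.continuous_sum (hdist : ∀ a b : Gr Δ, dist a b = rdist a b)
    (hbdist : ∀ a b : BGr Δ, dist a b = brdist a b) {f : BGr Δ → ℝ} (hf : Continuous f) :
    Continuous fun q : Gr Δ => ∑ p, f (q.bi p) := by
  refine continuous_iff_continuousAt.2 fun q => Metric.tendsto_nhds.2 fun ε hε => ?_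
  set δ : ℝ := ε / (Fintype.card q.RootNeighbors + 1) with hδ
  have hδ0 : 0 < δ := by positivity
  filter_upwards [Gr.eventually_exists_equiv hdist hbdist q
    (P := fun p b => dist (f b) (f (q.bi p)) < δ)
    fun p => Metric.tendsto_nhds.1 hf.continuousAt δ hδ0] with q' ⟨e, he⟩
  rw [← Equiv.sum_comp e]
  calc dist (∑ p, f (q'.bi (e p))) (∑ p, f (q.bi p))
      ≤ ∑ p, dist (f (q'.bi (e p))) (f (q.bi p)) := dist_sum_sum_le _ _ _
    _ ≤ ∑ _p : q.RootNeighbors, δ := Finset.sum_le_sum fun p _ => (he p).le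
    _ = Fintype.card q.RootNeighbors * δ := by simp
    _ < (Fintype.card q.RootNeighbors + 1) * δ := by nlinarith
    _ = ε := by rw [hδ]; field_simp

end Metric

section Measure

variable {Δ : ℕ} [MeasurableSpace (BGr Δ)]

lemma edgeKer_eq_sum (q : Gr Δ) : edgeKer q = ∑ p, Measure.dirac (q.bi p) :=
  Measure.sum_fintype _

lemma edgeKer_apply (q : Gr Δ) {A : Set (BGr Δ)} (hA : MeasurableSet A) :
    edgeKer q A = ∑ p, A.indicator 1 (q.bi p) := by
  simp [edgeKer_eq_sum, Measure.dirac_apply' _ hA]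

lemma edgeKer_univ_le (q : Gr Δ) : edgeKer q Set.univ ≤ Δ := by
  rw [edgeKer_apply q .univ]
  simpa using q.card_rootNeighbors_le

instance (q : Gr Δ) : IsFiniteMeasure (edgeKer q) :=
  ⟨(edgeKer_univ_le q).trans_lt (natCast_lt_top Δ)⟩

variable [MetricSpace (BGr Δ)] [BorelSpace (BGr Δ)]

lemma integrable_edgeKer (q : Gr Δ) {f : BGr Δ → ℝ} (hf : Continuous f) :
    Integrable f (edgeKer q) := by
  rw [edgeKer_eq_sum, integrable_finsetSum_measure]
  exact fun p _ => integrable_dirac' hf.stronglyMeasurable (by simp)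

lemma integral_edgeKer (q : Gr Δ) {f : BGr Δ → ℝ} (hf : Continuous f) :
    ∫ b, f b ∂edgeKer q = ∑ p, f (q.bi p) := by
  rw [edgeKer_eq_sum, integral_finsetSum_measure
    fun p _ => integrable_dirac' hf.stronglyMeasurable (by simp)]
  exact Finset.sum_congr rfl fun p _ => integral_dirac' _ _ hf.stronglyMeasurable

variable [MetricSpace (Gr Δ)]

lemma lowerSemicontinuous_edgeKer (hdist : ∀ a b : Gr Δ, dist a b = rdist a b)
    (hbdist : ∀ a b : BGr Δ, dist a b = brdist a b) {U : Set (BGr Δ)} (hU : IsOpen U) :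
    LowerSemicontinuous fun q : Gr Δ => edgeKer q U := by
  intro q c hc
  filter_upwards [Gr.eventually_exists_equiv hdist hbdist q
    (P := fun p b => q.bi p ∈ U → b ∈ U) fun p => by
      by_cases hp : q.bi p ∈ U
      · filter_upwards [hU.mem_nhds hp] with b hb _ using hb
      · simp [hp]] with q' ⟨e, he⟩
  refine hc.trans_le ?_
  dsimp only
  rw [edgeKer_apply _ hU.measurableSet, edgeKer_apply _ hU.measurableSet, ← Equiv.sum_comp e]
  refine Finset.sum_le_sum fun p _ => ?_
  by_cases hp : q.bi p ∈ U
  · simp [hp, he p hp]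
  · simp [hp]

variable [MeasurableSpace (Gr Δ)] [BorelSpace (Gr Δ)]

lemma measurable_edgeKer (hdist : ∀ a b : Gr Δ, dist a b = rdist a b)
    (hbdist : ∀ a b : BGr Δ, dist a b = brdist a b) :
    Measurable (edgeKer : Gr Δ → Measure (BGr Δ)) :=
  .measure_of_isPiSystem (BorelSpace.measurable_eq (α := BGr Δ)) isPiSystem_isOpen
    (fun _ hU => (lowerSemicontinuous_edgeKer hdist hbdist hU).measurable)
    (lowerSemicontinuous_edgeKer hdist hbdist isOpen_univ).measurable

/-- `edgeKer` as a bundled kernel. -/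
noncomputable def edgeKernel (hdist : ∀ a b : Gr Δ, dist a b = rdist a b)
    (hbdist : ∀ a b : BGr Δ, dist a b = brdist a b) :
    ProbabilityTheory.Kernel (Gr Δ) (BGr Δ) :=
  ⟨edgeKer, measurable_edgeKer hdist hbdist⟩

lemma integrable_vecM_iff (hdist : ∀ a b : Gr Δ, dist a b = rdist a b)
    (hbdist : ∀ a b : BGr Δ, dist a b = brdist a b) (ν : Measure (Gr Δ))
    {f : BGr Δ → ℝ} (hf : Continuous f) :
    Integrable f (vecM ν) ↔ Integrable (fun q : Gr Δ => ∑ p, |f (q.bi p)|) ν := by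
  have hfm : AEStronglyMeasurable f (ν.bind (edgeKernel hdist hbdist)) :=
    hf.stronglyMeasurable.aestronglyMeasurable
  refine (Measure.integrable_comp_iff hfm).trans ?_
  simp only [edgeKernel, ProbabilityTheory.Kernel.coe_mk, integrable_edgeKer _ hf,
    eventually_true, true_and, integral_edgeKer _ hf.abs, Real.norm_eq_abs]

lemma integral_vecM (hdist : ∀ a b : Gr Δ, dist a b = rdist a b)
    (hbdist : ∀ a b : BGr Δ, dist a b = brdist a b) (ν : Measure (Gr Δ))
    {f : BGr Δ → ℝ} (hf : Continuous f) (hint : Integrable f (vecM ν)) :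
    ∫ b, f b ∂vecM ν = ∫ q, ∑ p, f (q.bi p) ∂ν := by
  simp only [← integral_edgeKer _ hf]
  have hcomp : vecM ν = (edgeKernel hdist hbdist).comp (.const Unit ν) () := by
    rw [← Measure.comp_eq_comp_const_apply]
    rfl
  rw [hcomp] at hint ⊢
  rw [ProbabilityTheory.Kernel.integral_comp hint, ProbabilityTheory.Kernel.const_apply]
  rfl

end Measure

/-- Weak convergence, as tested on all continuous functions, forces integrability of a positive
continuous function to be the same for the limit and for all late terms of the sequence. -/
lemma WeakConv.eventually_integrable_iff {α : Type*} [TopologicalSpace α] [MeasurableSpace α]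
    {μn : ℕ → Measure α} {μ : Measure α} [∀ n, IsProbabilityMeasure (μn n)]
    [IsProbabilityMeasure μ] (h : WeakConv μn μ) {g : α → ℝ} (hg : Continuous g)
    (hg0 : ∀ x, 0 ≤ g x) : ∀ᶠ n in atTop, (Integrable g (μn n) ↔ Integrable g μ) := by
  have hadd (ν : Measure α) [IsProbabilityMeasure ν] :
      Integrable (fun x => g x + 1) ν ↔ Integrable g ν := by
    refine ⟨fun hi => ?_, fun hi => hi.add (integrable_const 1)⟩
    exact (hi.sub (integrable_const (1 : ℝ))).congr (.of_forall fun x => by simp)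
  have hone (ν : Measure α) [IsProbabilityMeasure ν] (hi : Integrable g ν) :
      1 ≤ ∫ x, g x + 1 ∂ν := by
    rw [integral_add hi (integrable_const 1)]
    simpa using integral_nonneg hg0
  have hlim := h (fun x => g x + 1) (by fun_prop)
  by_cases hi : Integrable g μ
  · filter_upwards [hlim.eventually_const_lt (zero_lt_one.trans_le (hone μ hi))] with n hn
    refine iff_of_true ?_ hi
    by_contra hni
    rw [integral_undef ((hadd _).not.2 hni)] at hn
    exact hn.false
  · rw [integral_undef ((hadd μ).not.2 hi)] at hlim
    filter_upwards [hlim.eventually_lt_const one_pos] with n hn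
    exact iff_of_false (fun hni => (hone _ hni).not_gt hn) hi

/-- If `μₙ → μ` weakly on `Gr`, then the edge measures satisfy `μ⃗ₙ → μ⃗` weakly
on `Gr⃗`. -/
theorem vecM_weakConv (Δ : ℕ)
    [MetricSpace (Gr Δ)] (hdist : ∀ a b : Gr Δ, dist a b = rdist a b)
    [MeasurableSpace (Gr Δ)] [BorelSpace (Gr Δ)]
    [MetricSpace (BGr Δ)] (hbdist : ∀ a b : BGr Δ, dist a b = brdist a b)
    [MeasurableSpace (BGr Δ)] [BorelSpace (BGr Δ)]
    (μn : ℕ → Measure (Gr Δ)) (μ : Measure (Gr Δ))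
    [∀ n, IsProbabilityMeasure (μn n)] [IsProbabilityMeasure μ]
    (h : WeakConv μn μ) :
    WeakConv (fun n => vecM (μn n)) (vecM μ) := by
  intro f hf
  have hev := h.eventually_integrable_iff
    (Gr.continuous_sum hdist hbdist (f := fun b => |f b|) (by fun_prop))
    fun q => Finset.sum_nonneg fun p _ => abs_nonneg _
  simp only [← integrable_vecM_iff hdist hbdist _ hf] at hev
  by_cases hi : Integrable f (vecM μ)
  · rw [integral_vecM hdist hbdist μ hf hi]
    refine (h _ (Gr.continuous_sum hdist hbdist hf)).congr' ?_
    filter_upwards [hev] with n hn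
    rw [integral_vecM hdist hbdist _ hf (hn.2 hi)]
  · rw [integral_undef hi]
    refine tendsto_const_nhds.congr' ?_
    filter_upwards [hev] with n hn
    rw [integral_undef (hn.not.2 hi)]
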